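/- Let d ≥ 1, K ⊆ ℝ^d compact, U a compact set, A a symmetric d × d real matrix, and M, K₁, K₂, K₃, M_b ≥ 0. Let b : K × P(K) × U → ℝ^d satisfy |b| ≤ M_b and |b(x, μ, α) − b(y, ν, α)| ≤ K₁(|x − y| + W₂(μ, ν)); let ϑ : K × P(K) × U → ℝ satisfy |ϑ| ≤ K₂ and |ϑ(x, μ, α) − ϑ(y, ν, α)| ≤ K₃(|x − y| + W₂(μ, ν)). Let G_n, G : K → ℝ^d be continuously differentiable with |G_n|, |∇G_n|, |G|, |∇G| ≤ M and G, ∇G continuous, and suppose: W₁(μ_n, μ) → 0 and W₂(μ_n, μ) → 0; for every ε > 0, μ_n({|G_n − G| ≥ ε}) → 0 and μ_n({|∇G_n − ∇G| ≥ ε}) → 0. Define H_n(α) := ∫_K ⟨G_n(x), b(x, μ_n, α)⟩ dμ_n(x) + ½ ∫_K tr(A ∇G_n(x)) dμ_n(x) + ∫_K ϑ(x, μ_n, α) dμ_n(x), and H(α) analogously with G, μ. Then sup_{α ∈ U} |H_n(α) − H(α)| → 0 as n → ∞. -/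

import Mathlib

open MeasureTheory

/-- A coupling of `μ` and `ν`: a probability measure on the product whose marginals
are `μ` and `ν` respectively. -/
def IsCoupling {d : ℕ} (μ ν : Measure (EuclideanSpace ℝ (Fin d)))
    (Γ : Measure (EuclideanSpace ℝ (Fin d) × EuclideanSpace ℝ (Fin d))) : Prop :=
  IsProbabilityMeasure Γ ∧ Γ.map Prod.fst = μ ∧ Γ.map Prod.snd = ν

/-- The `L^p`-Wasserstein distance `W_p(μ,ν) = inf_Γ (∫ |x-y|^p dΓ)^(1/p)`, the infimum
running over all couplings `Γ` of `μ` and `ν`. -/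
noncomputable def wasserstein {d : ℕ} (p : ℝ)
    (μ ν : Measure (EuclideanSpace ℝ (Fin d))) : ℝ :=
  sInf { c : ℝ | ∃ Γ : Measure (EuclideanSpace ℝ (Fin d) × EuclideanSpace ℝ (Fin d)),
    IsCoupling μ ν Γ ∧ c = (∫ z, ‖z.1 - z.2‖ ^ p ∂Γ) ^ (1 / p) }

open Filter

open scoped RealInnerProductSpace

section WassersteinEstimates

variable {d : ℕ} {K : Set (EuclideanSpace ℝ (Fin d))}
  {μ ν : Measure (EuclideanSpace ℝ (Fin d))}

lemma bddBelow_wasserstein_costs (p : ℝ) (μ ν : Measure (EuclideanSpace ℝ (Fin d))) :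
    BddBelow { c : ℝ | ∃ Γ : Measure (EuclideanSpace ℝ (Fin d) × EuclideanSpace ℝ (Fin d)),
      IsCoupling μ ν Γ ∧ c = (∫ z, ‖z.1 - z.2‖ ^ p ∂Γ) ^ (1 / p) } := by
  refine ⟨0, ?_⟩
  rintro c ⟨Γ, -, rfl⟩
  positivity

lemma wasserstein_nonneg (p : ℝ) (μ ν : Measure (EuclideanSpace ℝ (Fin d))) :
    0 ≤ wasserstein p μ ν := by
  refine Real.sInf_nonneg ?_
  rintro c ⟨Γ, -, rfl⟩
  positivity

lemma wasserstein_self {p : ℝ} (hp : p ≠ 0) (μ : Measure (EuclideanSpace ℝ (Fin d)))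
    [IsProbabilityMeasure μ] : wasserstein p μ μ = 0 := by
  refine le_antisymm (csInf_le (bddBelow_wasserstein_costs p μ μ) ?_) (wasserstein_nonneg p μ μ)
  have hm : Measurable fun x : EuclideanSpace ℝ (Fin d) => (x, x) :=
    measurable_id.prodMk measurable_id
  refine ⟨μ.map fun x => (x, x),
    ⟨Measure.isProbabilityMeasure_map hm.aemeasurable, ?_, ?_⟩, ?_⟩
  · rw [Measure.map_map measurable_fst hm]; exact Measure.map_id
  · rw [Measure.map_map measurable_snd hm]; exact Measure.map_id
  · have hc : Measurable fun z : EuclideanSpace ℝ (Fin d) × EuclideanSpace ℝ (Fin d) =>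
        ‖z.1 - z.2‖ ^ p := by fun_prop
    rw [integral_map hm.aemeasurable hc.aestronglyMeasurable]
    simp [Real.zero_rpow hp, Real.zero_rpow (inv_ne_zero hp)]

/-- There are couplings whose transport cost is arbitrarily close to `wasserstein 1`. -/
lemma exists_isCoupling_integral_lt [IsProbabilityMeasure μ] [IsProbabilityMeasure ν]
    {r : ℝ} (hr : wasserstein 1 μ ν < r) :
    ∃ Γ, IsCoupling μ ν Γ ∧ ∫ z, ‖z.1 - z.2‖ ∂Γ < r := by
  have hne : { c : ℝ | ∃ Γ : Measure (EuclideanSpace ℝ (Fin d) × EuclideanSpace ℝ (Fin d)),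
      IsCoupling μ ν Γ ∧ c = (∫ z, ‖z.1 - z.2‖ ^ (1 : ℝ) ∂Γ) ^ (1 / (1 : ℝ)) }.Nonempty :=
    ⟨_, μ.prod ν, ⟨inferInstance, by simp, by simp⟩, rfl⟩
  obtain ⟨c, ⟨Γ, hΓ, rfl⟩, hc⟩ := exists_lt_of_csInf_lt hne hr
  exact ⟨Γ, hΓ, by simpa using hc⟩

lemma ae_mem_of_compl_null (hμ : μ Kᶜ = 0) : ∀ᵐ x ∂μ, x ∈ K := by
  exact mem_ae_iff.2 hμ

lemma ContinuousOn.integrable_of_compl_null [IsProbabilityMeasure μ] {F : Type*}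
    [NormedAddCommGroup F] {f : EuclideanSpace ℝ (Fin d) → F}
    (hf : ContinuousOn f K) (hK : IsCompact K) (hμ : μ Kᶜ = 0) : Integrable f μ := by
  have h := hf.integrableOn_compact (μ := μ) hK
  rwa [IntegrableOn, Measure.restrict_eq_self_of_ae_mem (ae_mem_of_compl_null hμ)] at h

lemma abs_integral_sub_integral_le_wasserstein
    [IsProbabilityMeasure μ] [IsProbabilityMeasure ν] (hK : IsCompact K)
    (hμ : μ Kᶜ = 0) (hν : ν Kᶜ = 0) {f g h : EuclideanSpace ℝ (Fin d) → ℝ}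
    (hf : ContinuousOn f K) (hg : ContinuousOn g K) (hh : ContinuousOn h K) {C : ℝ} (hC : 0 ≤ C)
    (hfg : ∀ x ∈ K, ∀ y ∈ K, |f x - g y| ≤ h x + C * ‖x - y‖) :
    |∫ x, f x ∂μ - ∫ y, g y ∂ν| ≤ ∫ x, h x ∂μ + C * wasserstein 1 μ ν := by
  have key : ∀ r, wasserstein 1 μ ν < r →
      |∫ x, f x ∂μ - ∫ y, g y ∂ν| ≤ ∫ x, h x ∂μ + C * r := by
    intro r hr
    obtain ⟨Γ, ⟨hΓ, h1, h2⟩, hlt⟩ := exists_isCoupling_integral_lt hr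
    have hfi := hf.integrable_of_compl_null hK hμ
    have hgi := hg.integrable_of_compl_null hK hν
    have hhi := hh.integrable_of_compl_null hK hμ
    have hni : Integrable (fun x => x) μ := continuousOn_id.integrable_of_compl_null hK hμ
    have hni' : Integrable (fun x => x) ν := continuousOn_id.integrable_of_compl_null hK hν
    have hm := ae_mem_of_compl_null hμ
    have hm' := ae_mem_of_compl_null hν
    rw [← h1] at hfi hhi hni hm ⊢
    rw [← h2] at hgi hni' hm' ⊢
    rw [integral_map measurable_fst.aemeasurable hfi.aestronglyMeasurable,
      integral_map measurable_fst.aemeasurable hhi.aestronglyMeasurable,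
      integral_map measurable_snd.aemeasurable hgi.aestronglyMeasurable]
    have hfi' : Integrable (fun z => f z.1) Γ := hfi.comp_measurable measurable_fst
    have hhi' : Integrable (fun z => h z.1) Γ := hhi.comp_measurable measurable_fst
    have hgi' : Integrable (fun z => g z.2) Γ := hgi.comp_measurable measurable_snd
    have hdi : Integrable (fun z : EuclideanSpace ℝ (Fin d) × EuclideanSpace ℝ (Fin d) =>
        ‖z.1 - z.2‖) Γ :=
      ((hni.comp_measurable measurable_fst).sub (hni'.comp_measurable measurable_snd)).norm
    have hz := ae_of_ae_map measurable_fst.aemeasurable hm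
    have hz' := ae_of_ae_map measurable_snd.aemeasurable hm'
    calc |∫ z, f z.1 ∂Γ - ∫ z, g z.2 ∂Γ| = |∫ z, (f z.1 - g z.2) ∂Γ| := by
          rw [integral_sub hfi' hgi']
      _ ≤ ∫ z, |f z.1 - g z.2| ∂Γ := abs_integral_le_integral_abs
      _ ≤ ∫ z, (h z.1 + C * ‖z.1 - z.2‖) ∂Γ := by
          refine integral_mono_ae (hfi'.sub hgi').abs (hhi'.add (hdi.const_mul C)) ?_
          filter_upwards [hz, hz'] with z hz hz' using hfg _ hz _ hz'
      _ = ∫ z, h z.1 ∂Γ + C * ∫ z, ‖z.1 - z.2‖ ∂Γ := by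
          rw [integral_add hhi' (hdi.const_mul C), integral_const_mul]
      _ ≤ ∫ z, h z.1 ∂Γ + C * r := by gcongr
  have ht : Tendsto (fun r : ℝ => ∫ x, h x ∂μ + C * r) (nhdsWithin (wasserstein 1 μ ν)
      (Set.Ioi (wasserstein 1 μ ν))) (nhds (∫ x, h x ∂μ + C * wasserstein 1 μ ν)) :=
    Continuous.tendsto' (by fun_prop) _ _ rfl |>.mono_left nhdsWithin_le_nhds
  exact ge_of_tendsto ht (eventually_nhdsWithin_of_forall key)

/-- Convergence to zero in measure of uniformly bounded functions implies convergence of their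
integrals, for varying probability measures. -/
lemma tendsto_integral_of_tendsto_measure_le (hK : IsCompact K)
    {μ : ℕ → Measure (EuclideanSpace ℝ (Fin d))} [∀ n, IsProbabilityMeasure (μ n)]
    (hμ : ∀ n, μ n Kᶜ = 0) {h : ℕ → EuclideanSpace ℝ (Fin d) → ℝ}
    (hh : ∀ n, ContinuousOn (h n) K) (h0 : ∀ n x, 0 ≤ h n x) {B : ℝ}
    (hB : ∀ n, ∀ x ∈ K, h n x ≤ B)
    (hconv : ∀ ε > (0 : ℝ), Tendsto (fun n => μ n {x ∈ K | ε ≤ h n x}) atTop (nhds 0)) :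
    Tendsto (fun n => ∫ x, h n x ∂(μ n)) atTop (nhds 0) := by
  rw [Metric.tendsto_atTop]
  intro ε hε
  have ht : Tendsto (fun n => ε / 2 + |B| * (μ n).real {x ∈ K | ε / 2 ≤ h n x}) atTop
      (nhds (ε / 2 + |B| * 0)) := by
    have := (ENNReal.tendsto_toReal ENNReal.zero_ne_top).comp (hconv (ε / 2) (by positivity))
    exact (this.const_mul |B|).const_add _
  obtain ⟨N, hN⟩ := eventually_atTop.1
    (ht.eventually_lt_const (show ε / 2 + |B| * 0 < ε by linarith))
  refine ⟨N, fun n hn => ?_⟩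
  rw [Real.dist_eq, sub_zero, abs_of_nonneg (integral_nonneg (h0 n))]
  refine lt_of_le_of_lt ?_ (hN n hn)
  have hS : MeasurableSet {x ∈ K | ε / 2 ≤ h n x} :=
    ((hh n).preimage_isClosed_of_isClosed hK.isClosed isClosed_Ici).measurableSet
  have hSi : Integrable ({x ∈ K | ε / 2 ≤ h n x}.indicator fun _ => |B|) (μ n) :=
    (integrable_const _).indicator hS
  calc ∫ x, h n x ∂(μ n)
      ≤ ∫ x, (ε / 2 + {x ∈ K | ε / 2 ≤ h n x}.indicator (fun _ => |B|) x) ∂(μ n) := by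
        refine integral_mono_ae ((hh n).integrable_of_compl_null hK (hμ n))
          ((integrable_const _).add hSi) ?_
        filter_upwards [ae_mem_of_compl_null (hμ n)] with x hx
        by_cases hx' : ε / 2 ≤ h n x
        · rw [Set.indicator_of_mem (show x ∈ {x ∈ K | ε / 2 ≤ h n x} from ⟨hx, hx'⟩)]
          linarith [hB n x hx, le_abs_self B]
        · rw [Set.indicator_of_notMem (fun hmem => hx' hmem.2)]
          linarith
    _ = ε / 2 + |B| * (μ n).real {x ∈ K | ε / 2 ≤ h n x} := by
        rw [integral_add (integrable_const _) hSi, integral_indicator_const _ hS]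
        simp [mul_comm]

/-- A continuous function on a compact set is Lipschitz up to an arbitrarily small error. -/
lemma IsCompact.exists_norm_sub_le_add_mul {E F : Type*} [NormedAddCommGroup E]
    [NormedAddCommGroup F] {K : Set E} (hK : IsCompact K) {f : E → F} (hf : ContinuousOn f K)
    {ε : ℝ} (hε : 0 < ε) :
    ∃ C, 0 ≤ C ∧ ∀ x ∈ K, ∀ y ∈ K, ‖f x - f y‖ ≤ ε + C * ‖x - y‖ := by
  obtain ⟨η, hη, huc⟩ := Metric.uniformContinuousOn_iff.1
    (hK.uniformContinuousOn_of_continuous hf) ε hε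
  obtain ⟨B, hB⟩ := hK.exists_bound_of_continuousOn hf
  refine ⟨2 * |B| / η, by positivity, fun x hx y hy => ?_⟩
  by_cases hxy : ‖x - y‖ < η
  · have h1 := huc x hx y hy (by rwa [dist_eq_norm])
    rw [dist_eq_norm] at h1
    have : 0 ≤ 2 * |B| / η * ‖x - y‖ := by positivity
    linarith
  · have h1 : 2 * |B| ≤ 2 * |B| / η * ‖x - y‖ := by
      rw [div_mul_eq_mul_div, le_div_iff₀ hη]
      gcongr
      exact not_lt.1 hxy
    linarith [norm_sub_le (f x) (f y), hB x hx, hB y hy, le_abs_self B]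

lemma continuousOn_of_norm_sub_le_wasserstein {F : Type*} [NormedAddCommGroup F]
    [IsProbabilityMeasure μ] {f : EuclideanSpace ℝ (Fin d) → F} {C p : ℝ} (hp : p ≠ 0)
    (hf : ∀ x ∈ K, ∀ y ∈ K, ‖f x - f y‖ ≤ C * (‖x - y‖ + wasserstein p μ μ)) :
    ContinuousOn f K := by
  refine (LipschitzOnWith.of_dist_le' (K := C) fun x hx y hy => ?_).continuousOn
  simpa [dist_eq_norm, wasserstein_self hp] using hf x hx y hy

lemma abs_sum_mul_apply_single_le (A : Matrix (Fin d) (Fin d) ℝ)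
    (L : EuclideanSpace ℝ (Fin d) →L[ℝ] EuclideanSpace ℝ (Fin d)) :
    |∑ i, ∑ j, A i j * L (EuclideanSpace.single j 1) i| ≤ (∑ i, ∑ j, |A i j|) * ‖L‖ := by
  simp_rw [Finset.sum_mul]
  refine (Finset.abs_sum_le_sum_abs _ _).trans (Finset.sum_le_sum fun i _ => ?_)
  refine (Finset.abs_sum_le_sum_abs _ _).trans (Finset.sum_le_sum fun j _ => ?_)
  rw [abs_mul]
  gcongr
  calc |L (EuclideanSpace.single j 1) i| ≤ ‖L (EuclideanSpace.single j 1)‖ :=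
        PiLp.norm_apply_le (L (EuclideanSpace.single j 1)) i
    _ ≤ ‖L‖ := by simpa using L.le_opNorm (EuclideanSpace.single j 1)

end WassersteinEstimates

/-- Lemma 3.8: convergence of the Hamiltonian
`H(μ, G, α) = ∫⟨G, b(·,μ,α)⟩ dμ + ½ ∫ tr(A ∇G) dμ + ∫ ϑ(·,μ,α) dμ`,
uniformly in the control `α ∈ U`, along a sequence `μₙ → μ` in `W₁` and `W₂`,
where `Gₙ = D^Lψ(t, μₙ)` and `G = D^Lψ(t, μ)` satisfy the boundedness and
convergence-in-measure conditions of Definition 3.3. -/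
theorem tendstoUniformly_hamiltonian {d : ℕ} (hd : 1 ≤ d)
    (K : Set (EuclideanSpace ℝ (Fin d))) (hK : IsCompact K)
    (U : Type) [TopologicalSpace U] [CompactSpace U]
    (A : Matrix (Fin d) (Fin d) ℝ) (hA : A.IsSymm)
    (M K₁ K₂ K₃ Mb : ℝ)
    (b : EuclideanSpace ℝ (Fin d) → Measure (EuclideanSpace ℝ (Fin d)) → U →
      EuclideanSpace ℝ (Fin d))
    (hbbd : ∀ x ∈ K, ∀ (ρ : Measure (EuclideanSpace ℝ (Fin d))),
      IsProbabilityMeasure ρ → ρ Kᶜ = 0 → ∀ α : U, ‖b x ρ α‖ ≤ Mb)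
    (hblip : ∀ x ∈ K, ∀ y ∈ K, ∀ (ρ σ : Measure (EuclideanSpace ℝ (Fin d))),
      IsProbabilityMeasure ρ → IsProbabilityMeasure σ → ρ Kᶜ = 0 → σ Kᶜ = 0 → ∀ α : U,
      ‖b x ρ α - b y σ α‖ ≤ K₁ * (‖x - y‖ + wasserstein 2 ρ σ))
    (ϑ : EuclideanSpace ℝ (Fin d) → Measure (EuclideanSpace ℝ (Fin d)) → U → ℝ)
    (hϑbd : ∀ x ∈ K, ∀ (ρ : Measure (EuclideanSpace ℝ (Fin d))),
      IsProbabilityMeasure ρ → ρ Kᶜ = 0 → ∀ α : U, |ϑ x ρ α| ≤ K₂)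
    (hϑlip : ∀ x ∈ K, ∀ y ∈ K, ∀ (ρ σ : Measure (EuclideanSpace ℝ (Fin d))),
      IsProbabilityMeasure ρ → IsProbabilityMeasure σ → ρ Kᶜ = 0 → σ Kᶜ = 0 → ∀ α : U,
      |ϑ x ρ α - ϑ y σ α| ≤ K₃ * (‖x - y‖ + wasserstein 2 ρ σ))
    (G : ℕ → EuclideanSpace ℝ (Fin d) → EuclideanSpace ℝ (Fin d))
    (G' : EuclideanSpace ℝ (Fin d) → EuclideanSpace ℝ (Fin d))
    (hGdiff : ∀ n, ContDiff ℝ 1 (G n)) (hG'diff : ContDiff ℝ 1 G')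
    (hGbd : ∀ n, ∀ x ∈ K, ‖G n x‖ ≤ M ∧ ‖fderiv ℝ (G n) x‖ ≤ M)
    (hG'bd : ∀ x ∈ K, ‖G' x‖ ≤ M ∧ ‖fderiv ℝ G' x‖ ≤ M)
    (μ : ℕ → Measure (EuclideanSpace ℝ (Fin d))) (ν : Measure (EuclideanSpace ℝ (Fin d)))
    [∀ n, IsProbabilityMeasure (μ n)] [IsProbabilityMeasure ν]
    (hμK : ∀ n, μ n Kᶜ = 0) (hνK : ν Kᶜ = 0)
    (hW1 : Tendsto (fun n => wasserstein 1 (μ n) ν) atTop (nhds 0))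
    (hW2 : Tendsto (fun n => wasserstein 2 (μ n) ν) atTop (nhds 0))
    (hGconv : ∀ ε > (0 : ℝ),
      Tendsto (fun n => μ n {x ∈ K | ε ≤ ‖G n x - G' x‖}) atTop (nhds 0))
    (hDGconv : ∀ ε > (0 : ℝ),
      Tendsto (fun n => μ n {x ∈ K | ε ≤ ‖fderiv ℝ (G n) x - fderiv ℝ G' x‖}) atTop
        (nhds 0)) :
    TendstoUniformly
      (fun n (α : U) =>
        (∫ x in K, ⟪G n x, b x (μ n) α⟫ ∂(μ n)) +
        (1 / 2) * (∫ x in K,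
          (∑ i, ∑ j, A i j * fderiv ℝ (G n) x (EuclideanSpace.single j 1) i) ∂(μ n)) +
        ∫ x in K, ϑ x (μ n) α ∂(μ n))
      (fun α =>
        (∫ x in K, ⟪G' x, b x ν α⟫ ∂ν) +
        (1 / 2) * (∫ x in K,
          (∑ i, ∑ j, A i j * fderiv ℝ G' x (EuclideanSpace.single j 1) i) ∂ν) +
        ∫ x in K, ϑ x ν α ∂ν)
      atTop := by
  set T : (EuclideanSpace ℝ (Fin d) →L[ℝ] EuclideanSpace ℝ (Fin d)) → ℝ :=
    fun L => ∑ i, ∑ j, A i j * L (EuclideanSpace.single j 1) i with hT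
  have hTcont : Continuous T := by
    rw [hT]; fun_prop
  set a := ∑ i, ∑ j, |A i j| with ha
  have ha0 : 0 ≤ a := by positivity
  have hTsub : ∀ L L', |T L - T L'| ≤ a * ‖L - L'‖ := by
    intro L L'
    refine le_of_eq_of_le ?_ (abs_sum_mul_apply_single_le A (L - L'))
    simp [hT, mul_sub, Finset.sum_sub_distrib]
  have hDG : ∀ n, Continuous (fderiv ℝ (G n)) := fun n => (hGdiff n).continuous_fderiv one_ne_zero
  have hDG' : Continuous (fderiv ℝ G') := hG'diff.continuous_fderiv one_ne_zero
  have hbc : ∀ (ρ : Measure (EuclideanSpace ℝ (Fin d))) [IsProbabilityMeasure ρ], ρ Kᶜ = 0 →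
      ∀ α, ContinuousOn (fun x => b x ρ α) K := fun ρ hρ hρK α =>
    continuousOn_of_norm_sub_le_wasserstein (μ := ρ) two_ne_zero fun x hx y hy =>
      hblip x hx y hy ρ ρ hρ hρ hρK hρK α
  have hϑc : ∀ (ρ : Measure (EuclideanSpace ℝ (Fin d))) [IsProbabilityMeasure ρ], ρ Kᶜ = 0 →
      ∀ α, ContinuousOn (fun x => ϑ x ρ α) K := fun ρ hρ hρK α =>
    continuousOn_of_norm_sub_le_wasserstein (μ := ρ) two_ne_zero fun x hx y hy =>
      hϑlip x hx y hy ρ ρ hρ hρ hρK hρK α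
  have hsum : ∀ (ρ : Measure (EuclideanSpace ℝ (Fin d))) [IsProbabilityMeasure ρ], ρ Kᶜ = 0 →
      ∀ Γ : EuclideanSpace ℝ (Fin d) → EuclideanSpace ℝ (Fin d), ContDiff ℝ 1 Γ → ∀ α,
      ContinuousOn (fun x => ⟪Γ x, b x ρ α⟫ + 1 / 2 * T (fderiv ℝ Γ x) + ϑ x ρ α) K ∧
      (∫ x in K, ⟪Γ x, b x ρ α⟫ ∂ρ) + (1 / 2) * (∫ x in K, T (fderiv ℝ Γ x) ∂ρ) +
        ∫ x in K, ϑ x ρ α ∂ρ =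
      ∫ x, (⟪Γ x, b x ρ α⟫ + 1 / 2 * T (fderiv ℝ Γ x) + ϑ x ρ α) ∂ρ := by
    intro ρ hρ hρK Γ hΓ α
    have h1 : ContinuousOn (fun x => ⟪Γ x, b x ρ α⟫) K :=
      hΓ.continuous.continuousOn.inner (hbc ρ hρK α)
    have h2 : ContinuousOn (fun x => 1 / 2 * T (fderiv ℝ Γ x)) K :=
      (continuous_const.mul
        (hTcont.comp (hΓ.continuous_fderiv one_ne_zero))).continuousOn
    refine ⟨(h1.add h2).add (hϑc ρ hρK α), ?_⟩
    have i1 := h1.integrable_of_compl_null hK hρK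
    have i2 := h2.integrable_of_compl_null hK hρK
    have i12 : Integrable (fun x => ⟪Γ x, b x ρ α⟫ + 1 / 2 * T (fderiv ℝ Γ x)) ρ := i1.add i2
    have i3 := (hϑc ρ hρK α).integrable_of_compl_null hK hρK
    rw [Measure.restrict_eq_self_of_ae_mem (ae_mem_of_compl_null hρK),
      integral_add i12 i3, integral_add i1 i2, integral_const_mul]
  have hGint : Tendsto (fun n => ∫ x, ‖G n x - G' x‖ ∂(μ n)) atTop (nhds 0) :=
    tendsto_integral_of_tendsto_measure_le hK hμK
      (fun n => ((hGdiff n).continuous.sub hG'diff.continuous).norm.continuousOn)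
      (fun _ _ => norm_nonneg _)
      (fun n x hx => (norm_sub_le _ _).trans (add_le_add (hGbd n x hx).1 (hG'bd x hx).1)) hGconv
  have hDGint : Tendsto (fun n => ∫ x, ‖fderiv ℝ (G n) x - fderiv ℝ G' x‖ ∂(μ n)) atTop
      (nhds 0) :=
    tendsto_integral_of_tendsto_measure_le hK hμK
      (fun n => ((hDG n).sub hDG').norm.continuousOn)
      (fun _ _ => norm_nonneg _)
      (fun n x hx => (norm_sub_le _ _).trans (add_le_add (hGbd n x hx).2 (hG'bd x hx).2)) hDGconv
  rw [Metric.tendstoUniformly_iff]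
  intro ε hε
  set δ := ε / (2 * (|Mb| + a + 1)) with hδ
  have hδ0 : 0 < δ := by positivity
  obtain ⟨C, hC0, hC⟩ := hK.exists_norm_sub_le_add_mul hG'diff.continuous.continuousOn hδ0
  obtain ⟨D, hD0, hD⟩ := hK.exists_norm_sub_le_add_mul hDG'.continuousOn hδ0
  set e : ℕ → ℝ := fun n => (|Mb| + a) * δ + (|M| * |K₁| + |K₃|) * wasserstein 2 (μ n) ν with he
  set R := |Mb| * C + a * D + |M| * |K₁| + |K₃| with hR
  have hbound : Tendsto (fun n => |Mb| * (∫ x, ‖G n x - G' x‖ ∂(μ n)) +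
      a * (∫ x, ‖fderiv ℝ (G n) x - fderiv ℝ G' x‖ ∂(μ n)) + e n +
      R * wasserstein 1 (μ n) ν) atTop
      (nhds (|Mb| * 0 + a * 0 + ((|Mb| + a) * δ + (|M| * |K₁| + |K₃|) * 0) + R * 0)) :=
    (((hGint.const_mul _).add (hDGint.const_mul _)).add ((hW2.const_mul _).const_add _)).add
      (hW1.const_mul _)
  have hlt : |Mb| * 0 + a * 0 + ((|Mb| + a) * δ + (|M| * |K₁| + |K₃|) * 0) + R * 0 < ε := by
    have h1 : (|Mb| + a + 1) * δ = ε / 2 := by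
      rw [hδ]; field_simp
    nlinarith
  filter_upwards [hbound.eventually_lt_const hlt] with n hn α
  obtain ⟨hc, hint⟩ := hsum (μ n) (hμK n) (G n) (hGdiff n) α
  obtain ⟨hc', hint'⟩ := hsum ν hνK G' hG'diff α
  rw [dist_comm, Real.dist_eq]
  refine lt_of_le_of_lt ?_ hn
  simp only [hT] at hint hint'
  rw [hint, hint']
  have c1 : Continuous fun x => |Mb| * ‖G n x - G' x‖ :=
    continuous_const.mul ((hGdiff n).continuous.sub hG'diff.continuous).norm
  have c2 : Continuous fun x => a * ‖fderiv ℝ (G n) x - fderiv ℝ G' x‖ :=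
    continuous_const.mul ((hDG n).sub hDG').norm
  have i1 := c1.continuousOn.integrable_of_compl_null hK (hμK n)
  have i2 := c2.continuousOn.integrable_of_compl_null hK (hμK n)
  have i12 : Integrable
      (fun x => |Mb| * ‖G n x - G' x‖ + a * ‖fderiv ℝ (G n) x - fderiv ℝ G' x‖) (μ n) :=
    i1.add i2
  have hmain := abs_integral_sub_integral_le_wasserstein hK (hμK n) hνK hc hc'
    (h := fun x => |Mb| * ‖G n x - G' x‖ + a * ‖fderiv ℝ (G n) x - fderiv ℝ G' x‖ + e n)
    ((c1.add c2).add continuous_const).continuousOn (C := R) (by positivity) ?_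
  · rw [integral_add i12 (integrable_const _), integral_add i1 i2, integral_const_mul,
      integral_const_mul] at hmain
    simpa using hmain
  intro x hx y hy
  have hw := wasserstein_nonneg 2 (μ n) ν
  have hxy := norm_nonneg (x - y)
  have hb1 : ‖b x (μ n) α‖ ≤ |Mb| :=
    (hbbd x hx (μ n) inferInstance (hμK n) α).trans (le_abs_self _)
  have hb2 : ‖b x (μ n) α - b y ν α‖ ≤ |K₁| * (‖x - y‖ + wasserstein 2 (μ n) ν) :=
    (hblip x hx y hy _ _ inferInstance inferInstance (hμK n) hνK α).trans
      (mul_le_mul_of_nonneg_right (le_abs_self _) (by positivity))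
  have hϑ2 : |ϑ x (μ n) α - ϑ y ν α| ≤ |K₃| * (‖x - y‖ + wasserstein 2 (μ n) ν) :=
    (hϑlip x hx y hy _ _ inferInstance inferInstance (hμK n) hνK α).trans
      (mul_le_mul_of_nonneg_right (le_abs_self _) (by positivity))
  have hGM : ‖G' y‖ ≤ |M| := (hG'bd y hy).1.trans (le_abs_self _)
  have hGxy : ‖G n x - G' y‖ ≤ ‖G n x - G' x‖ + (δ + C * ‖x - y‖) :=
    (norm_sub_le_norm_sub_add_norm_sub _ (G' x) _).trans (by gcongr; exact hC x hx y hy)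
  have hDxy : ‖fderiv ℝ (G n) x - fderiv ℝ G' y‖ ≤
      ‖fderiv ℝ (G n) x - fderiv ℝ G' x‖ + (δ + D * ‖x - y‖) :=
    (norm_sub_le_norm_sub_add_norm_sub _ (fderiv ℝ G' x) _).trans (by gcongr; exact hD x hx y hy)
  have t1 : |⟪G n x, b x (μ n) α⟫ - ⟪G' y, b y ν α⟫| ≤
      |Mb| * (‖G n x - G' x‖ + (δ + C * ‖x - y‖)) +
      |M| * (|K₁| * (‖x - y‖ + wasserstein 2 (μ n) ν)) := by
    have hsplit : ⟪G n x, b x (μ n) α⟫ - ⟪G' y, b y ν α⟫ =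
        ⟪G n x - G' y, b x (μ n) α⟫ + ⟪G' y, b x (μ n) α - b y ν α⟫ := by
      rw [inner_sub_left, inner_sub_right]; ring
    rw [hsplit]
    refine (abs_add_le _ _).trans (add_le_add ?_ ?_)
    · rw [mul_comm]
      exact (abs_real_inner_le_norm _ _).trans (by gcongr)
    · exact (abs_real_inner_le_norm _ _).trans (by gcongr)
  have t2 : |1 / 2 * T (fderiv ℝ (G n) x) - 1 / 2 * T (fderiv ℝ G' y)| ≤
      a * (‖fderiv ℝ (G n) x - fderiv ℝ G' x‖ + (δ + D * ‖x - y‖)) := by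
    have h1 := (hTsub (fderiv ℝ (G n) x) (fderiv ℝ G' y)).trans
      (mul_le_mul_of_nonneg_left hDxy ha0)
    rw [← mul_sub, abs_mul, abs_of_pos (by norm_num : (0 : ℝ) < 1 / 2)]
    linarith [abs_nonneg (T (fderiv ℝ (G n) x) - T (fderiv ℝ G' y))]
  calc |⟪G n x, b x (μ n) α⟫ + 1 / 2 * T (fderiv ℝ (G n) x) + ϑ x (μ n) α -
        (⟪G' y, b y ν α⟫ + 1 / 2 * T (fderiv ℝ G' y) + ϑ y ν α)|
      = |(⟪G n x, b x (μ n) α⟫ - ⟪G' y, b y ν α⟫) +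
          (1 / 2 * T (fderiv ℝ (G n) x) - 1 / 2 * T (fderiv ℝ G' y)) +
          (ϑ x (μ n) α - ϑ y ν α)| := by congr 1; ring
    _ ≤ _ := (abs_add_three _ _ _).trans (add_le_add (add_le_add t1 t2) hϑ2)
    _ = _ := by simp only [he, hR]; ring
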